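/- Let m, n, k ≥ 1, let M denote the finite type of multi-indices J : Fin m → ℕ with |J| = k, and let p = card M. Let d ≥ 0 and let L : ((Fin n × M) → ℝ) × ((Fin d) → ℝ) → ℝ be a C^∞ function. Suppose that for every multi-index H with |H| = 2k and all α, β ∈ Fin n, the sum over all pairs (J, K) ∈ M × M with J + K = H of the second partial derivatives ∂²L/∂x_{(α,J)}∂x_{(β,K)} (derivatives taken in the first factor, along the coordinate directions indexed by (α,J) and (β,K)) vanishes identically. Then for every choice of p + 1 coordinate indices (α₀,J₀), (α₁,J₁), …, (α_p,J_p) ∈ Fin n × M, the (p+1)-fold iterated partial derivative of L along these coordinate directions of the first factor vanishes identically. -/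

import Mathlib

/-- The type of multi-indices `J : Fin m → ℕ` of length `k`. -/
abbrev MultiIndexLen (m k : ℕ) : Type := {J : Fin m → ℕ // ∑ i, J i = k}

instance MultiIndexLen.finite (m k : ℕ) : Finite (MultiIndexLen m k) :=
  Finite.of_injective
    (fun J => (fun i => (⟨J.1 i,
        Nat.lt_succ_of_le (le_trans
          (Finset.single_le_sum (fun j _ => Nat.zero_le (J.1 j)) (Finset.mem_univ i))
          (le_of_eq J.2))⟩ : Fin (k + 1))))
    (fun _ _ h => Subtype.ext (funext fun i => congrArg Fin.val (congrFun h i)))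

noncomputable instance MultiIndexLen.fintype (m k : ℕ) : Fintype (MultiIndexLen m k) :=
  Fintype.ofFinite _

/-- The standard basis vector of the first factor of the domain of the Lagrangian,
corresponding to the highest-order coordinate `u^α_J`. -/
noncomputable def basisVec (m n k d : ℕ) (idx : Fin n × MultiIndexLen m k) :
    ((Fin n × MultiIndexLen m k) → ℝ) × (Fin d → ℝ) :=
  (Pi.single idx 1, 0)

/-- There is a permutation with two prescribed values. -/
theorem exists_perm_map_pair {ι : Type*} [DecidableEq ι] {a b i j : ι} (hab : a ≠ b)
    (hij : i ≠ j) : ∃ σ : Equiv.Perm ι, σ a = i ∧ σ b = j := by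
  refine ⟨(Equiv.swap a i).trans (Equiv.swap (Equiv.swap a i b) j), ?_, by simp⟩
  have h : i ≠ Equiv.swap a i b := by
    intro h
    apply hab
    apply (Equiv.swap a i).injective
    rwa [Equiv.swap_apply_left]
  rw [Equiv.trans_apply, Equiv.swap_apply_left, Equiv.swap_apply_of_ne_of_ne h hij]

section IteratedDerivatives

variable {E ι : Type*} [NormedAddCommGroup E] [NormedSpace ℝ E] {L : E → ℝ}

theorem ContDiff.differentiable_iteratedFDeriv_of_top (hL : ContDiff ℝ (⊤ : ℕ∞) L) (M : ℕ) :
    Differentiable ℝ (iteratedFDeriv ℝ M L) :=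
  hL.differentiable_iteratedFDeriv (by exact_mod_cast WithTop.coe_lt_top M)

theorem ContDiff.contDiff_two_iteratedFDeriv (hL : ContDiff ℝ (⊤ : ℕ∞) L) (M : ℕ) :
    ContDiff ℝ 2 (iteratedFDeriv ℝ M L) :=
  (contDiff_infty.1 hL (2 + M)).iteratedFDeriv_right (by norm_cast)

theorem ContDiff.differentiable_iteratedFDeriv_apply (hL : ContDiff ℝ (⊤ : ℕ∞) L) {M : ℕ}
    (w : Fin M → E) : Differentiable ℝ (fun y => iteratedFDeriv ℝ M L y w) := fun z =>
  (ContinuousMultilinearMap.apply ℝ (fun _ : Fin M => E) ℝ w).differentiableAt.comp z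
    (hL.differentiable_iteratedFDeriv_of_top M z)

theorem fderiv_continuousMultilinearMap_apply {M : ℕ}
    {G : E → ContinuousMultilinearMap ℝ (fun _ : Fin M => E) ℝ} {z : E}
    (hG : DifferentiableAt ℝ G z) (w : Fin M → E) (u : E) :
    fderiv ℝ (fun y => G y w) z u = fderiv ℝ G z u w := by
  have h : HasFDerivAt (fun y => G y w)
      ((ContinuousMultilinearMap.apply ℝ (fun _ : Fin M => E) ℝ w).comp (fderiv ℝ G z)) z :=
    (ContinuousMultilinearMap.apply ℝ (fun _ : Fin M => E) ℝ w).hasFDerivAt.comp z hG.hasFDerivAt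
  rw [h.fderiv]
  rfl

theorem iteratedFDeriv_succ_apply_eq_fderiv (hL : ContDiff ℝ (⊤ : ℕ∞) L) {M : ℕ} (z : E)
    (u : Fin (M + 1) → E) :
    iteratedFDeriv ℝ (M + 1) L z u =
      fderiv ℝ (fun y => iteratedFDeriv ℝ M L y (Fin.tail u)) z (u 0) := by
  rw [iteratedFDeriv_succ_apply_left,
    fderiv_continuousMultilinearMap_apply (hL.differentiable_iteratedFDeriv_of_top M z)]

theorem iteratedFDeriv_add_two_apply (hL : ContDiff ℝ (⊤ : ℕ∞) L) {M : ℕ} (z : E)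
    (u : Fin (M + 2) → E) :
    iteratedFDeriv ℝ (M + 2) L z u =
      fderiv ℝ (fderiv ℝ (iteratedFDeriv ℝ M L)) z (u 0) (u 1) (Fin.tail (Fin.tail u)) := by
  have hG := hL.contDiff_two_iteratedFDeriv M
  have hG' : DifferentiableAt ℝ (fderiv ℝ (iteratedFDeriv ℝ M L)) z :=
    (hG.fderiv_right (m := 1) (by norm_num)).differentiable (by norm_num) z
  rw [iteratedFDeriv_succ_apply_eq_fderiv hL]
  simp only [iteratedFDeriv_succ_apply_left]
  rw [fderiv_continuousMultilinearMap_apply (hG'.clm_apply (differentiableAt_const _)),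
    fderiv_clm_apply hG' (differentiableAt_const _)]
  simp [Fin.tail]

/-- Iterated derivatives of a smooth function are invariant under adjacent transpositions. -/
theorem iteratedFDeriv_comp_swap_castSucc_succ (hL : ContDiff ℝ (⊤ : ℕ∞) L) :
    ∀ {M : ℕ} (i : Fin M) (u : Fin (M + 1) → E) (z : E),
      iteratedFDeriv ℝ (M + 1) L z (u ∘ Equiv.swap i.castSucc i.succ) =
        iteratedFDeriv ℝ (M + 1) L z u
  | 0, i, _, _ => i.elim0
  | M + 1, i, u, z => by
    induction i using Fin.cases with
    | zero =>
      have hG := hL.contDiff_two_iteratedFDeriv M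
      have htail : Fin.tail (Fin.tail (u ∘ Equiv.swap (0 : Fin (M + 2)) 1)) =
          Fin.tail (Fin.tail u) := by
        ext x
        simp only [Fin.tail, Function.comp_apply]
        rw [Equiv.swap_apply_of_ne_of_ne (by simp [Fin.ext_iff]) (by simp [Fin.ext_iff])]
      have hsymm : IsSymmSndFDerivAt ℝ (iteratedFDeriv ℝ M L) z :=
        hG.contDiffAt.isSymmSndFDerivAt (by simp)
      rw [Fin.castSucc_zero, Fin.succ_zero_eq_one, iteratedFDeriv_add_two_apply hL,
        iteratedFDeriv_add_two_apply hL, htail, Function.comp_apply, Function.comp_apply,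
        Equiv.swap_apply_left, Equiv.swap_apply_right, hsymm.eq]
    | succ i =>
      have htail : Fin.tail (u ∘ Equiv.swap i.succ.castSucc i.succ.succ) =
          Fin.tail u ∘ Equiv.swap i.castSucc i.succ := by
        ext x
        simp only [Fin.tail, Function.comp_apply, ← Fin.succ_castSucc]
        rw [← (Fin.succ_injective _).swap_apply]
      rw [iteratedFDeriv_succ_apply_eq_fderiv hL, iteratedFDeriv_succ_apply_eq_fderiv hL, htail]
      simp only [iteratedFDeriv_comp_swap_castSucc_succ hL]
      rw [Function.comp_apply, Equiv.swap_apply_of_ne_of_ne (by simp [Fin.ext_iff])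
        (by simp [Fin.ext_iff])]

/-- Iterated derivatives of a smooth function are symmetric. -/
theorem ContDiff.iteratedFDeriv_comp_perm_of_top (hL : ContDiff ℝ (⊤ : ℕ∞) L) {M : ℕ}
    (σ : Equiv.Perm (Fin (M + 1))) (u : Fin (M + 1) → E) (z : E) :
    iteratedFDeriv ℝ (M + 1) L z (u ∘ σ) = iteratedFDeriv ℝ (M + 1) L z u := by
  have hσ : σ ∈ Submonoid.closure
      (Set.range fun i : Fin M => Equiv.swap i.castSucc i.succ) := by
    rw [Equiv.Perm.mclosure_swap_castSucc_succ]
    trivial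
  induction hσ using Submonoid.closure_induction generalizing u with
  | mem τ hτ =>
    obtain ⟨i, rfl⟩ := hτ
    exact iteratedFDeriv_comp_swap_castSucc_succ hL i u z
  | one => rfl
  | mul τ τ' _ _ h h' => rw [Equiv.Perm.coe_mul, ← Function.comp_assoc, h', h]

/-- Differentiating a linear relation between `M`-fold derivatives in a direction `u`. -/
theorem sum_iteratedFDeriv_succ_eq_zero (hL : ContDiff ℝ (⊤ : ℕ∞) L) {M : ℕ} (s : Finset ι)
    (w : ι → Fin (M + 1) → E) (u : E) (hu : ∀ p, w p 0 = u)
    (h : ∀ z, ∑ p ∈ s, iteratedFDeriv ℝ M L z (Fin.tail (w p)) = 0) (z : E) :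
    ∑ p ∈ s, iteratedFDeriv ℝ (M + 1) L z (w p) = 0 := by
  simp only [iteratedFDeriv_succ_apply_eq_fderiv hL, hu]
  rw [← sum_apply,
    ← fderiv_fun_sum fun p _ => hL.differentiable_iteratedFDeriv_apply _ z, funext h]
  simp

/-- A linear relation between second derivatives gives the same relation between higher
derivatives, with the two distinguished directions in the last two slots. -/
theorem sum_iteratedFDeriv_update_last_eq_zero (hL : ContDiff ℝ (⊤ : ℕ∞) L) (s : Finset ι)
    (a b : ι → E) (h : ∀ z, ∑ p ∈ s, iteratedFDeriv ℝ 2 L z ![a p, b p] = 0) :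
    ∀ (N : ℕ) (u : Fin (N + 2) → E) (z : E),
      ∑ p ∈ s, iteratedFDeriv ℝ (N + 2) L z
        (Function.update (Function.update u (Fin.last N).castSucc (a p))
          (Fin.last (N + 1)) (b p)) = 0
  | 0, u, z => by
    rw [← h z]
    refine Finset.sum_congr rfl fun p _ => congrArg _ ?_
    ext x
    fin_cases x <;> simp [Function.update]
  | N + 1, u, z => by
    refine sum_iteratedFDeriv_succ_eq_zero hL s _ (u 0) (fun p => ?_) (fun z => ?_) z
    · rw [Function.update_of_ne (by simp [Fin.ext_iff]),
        Function.update_of_ne (by simp [Fin.ext_iff])]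
    · rw [← sum_iteratedFDeriv_update_last_eq_zero hL s a b h N (Fin.tail u) z]
      refine Finset.sum_congr rfl fun p _ => congrArg _ ?_
      rw [← Fin.succ_last (N + 1), Fin.tail_update_succ, ← Fin.succ_last N, ← Fin.succ_castSucc,
        Fin.tail_update_succ]

/-- A linear relation between second derivatives gives the same relation between higher
derivatives, with the two distinguished directions in arbitrary distinct slots. -/
theorem sum_iteratedFDeriv_update_eq_zero (hL : ContDiff ℝ (⊤ : ℕ∞) L) (s : Finset ι)
    (a b : ι → E) (h : ∀ z, ∑ p ∈ s, iteratedFDeriv ℝ 2 L z ![a p, b p] = 0)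
    {M : ℕ} (u : Fin M → E) {i j : Fin M} (hij : i ≠ j) (z : E) :
    ∑ p ∈ s, iteratedFDeriv ℝ M L z
      (Function.update (Function.update u i (a p)) j (b p)) = 0 := by
  obtain ⟨N, rfl⟩ : ∃ N, M = N + 2 := ⟨M - 2, by
    have := i.2; have := j.2; have := Fin.val_ne_of_ne hij; omega⟩
  obtain ⟨σ, rfl, rfl⟩ := exists_perm_map_pair
    (show (Fin.last N).castSucc ≠ Fin.last (N + 1) from (Fin.castSucc_lt_last _).ne) hij
  rw [← sum_iteratedFDeriv_update_last_eq_zero hL s a b h N (u ∘ σ) z]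
  refine Finset.sum_congr rfl fun p _ => ?_
  rw [← Function.update_comp_eq_of_injective _ σ.injective,
    ← Function.update_comp_eq_of_injective _ σ.injective]
  exact (hL.iteratedFDeriv_comp_perm_of_top σ _ z).symm

end IteratedDerivatives

/-- Effect on a sum of replacing two entries of a family. -/
theorem sum_update_update_add {ι A : Type*} [Fintype ι] [DecidableEq ι] (q : A → ℕ)
    (c : ι → A) {i j : ι} (hij : i ≠ j) (a b : A) :
    ∑ x, q (Function.update (Function.update c i a) j b x) + (q (c i) + q (c j)) =
      ∑ x, q (c x) + (q a + q b) := by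
  have h : ∀ f : ι → A, ∑ x, q (f x) =
      q (f i) + (q (f j) + ∑ x ∈ (Finset.univ.erase i).erase j, q (f x)) := fun f => by
    rw [Finset.add_sum_erase _ (fun x => q (f x)) (by simp [hij.symm]),
      Finset.add_sum_erase _ (fun x => q (f x)) (by simp)]
  rw [h, h c, Finset.sum_congr rfl (g := fun x => q (c x))]
  · simp only [Function.update_self, Function.update_of_ne hij]
    ring
  · intro x hx
    simp only [Finset.mem_erase, Finset.mem_univ, and_true] at hx
    rw [Function.update_of_ne hx.1, Function.update_of_ne hx.2]

/-- Strict convexity of the sum of squares, for multi-indices. -/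
theorem two_mul_sum_sq_lt {m : ℕ} {J K K' : Fin m → ℕ} (h : K + K' = J + J) (hne : K ≠ J) :
    ∑ i, J i ^ 2 + ∑ i, J i ^ 2 < ∑ i, K i ^ 2 + ∑ i, K' i ^ 2 := by
  rw [← Finset.sum_add_distrib, ← Finset.sum_add_distrib]
  have h' : ∀ i, K i + K' i = J i + J i := fun i => congrFun h i
  obtain ⟨i, hi⟩ := Function.ne_iff.1 hne
  refine Finset.sum_lt_sum (fun x _ => ?_) ⟨i, Finset.mem_univ i, ?_⟩
  · zify
    have : (K' x : ℤ) = 2 * J x - K x := by have := h' x; omega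
    rw [this]
    nlinarith [sq_nonneg ((K x : ℤ) - J x)]
  · zify
    have : (K' i : ℤ) = 2 * J i - K i := by have := h' i; omega
    rw [this]
    have : (K i : ℤ) - J i ≠ 0 := by omega
    nlinarith [sq_pos_of_ne_zero this]

/-- The squared Euclidean norm of a multi-index of length `k` is at most `k ^ 2`. -/
theorem MultiIndexLen.sum_sq_le {m k : ℕ} (J : MultiIndexLen m k) : ∑ i, J.1 i ^ 2 ≤ k ^ 2 := by
  simpa only [J.2] using Finset.sum_sq_le_sq_sum_of_nonneg (s := Finset.univ) (f := J.1) (by simp)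

/-- If, for every multi-index `H` of length `2k` and all `α β`, the sum over all pairs
`(J, K)` of multi-indices of length `k` with `J + K = H` of the second partial derivatives
`∂²L/∂x_{(α,J)}∂x_{(β,K)}` (in the first factor) vanishes identically, then every
`(p+1)`-fold iterated partial derivative of `L` along coordinate directions of the first
factor vanishes identically, where `p` is the number of multi-indices of length `k`. -/
theorem higher_derivatives_vanish (m n k d : ℕ) (hm : 1 ≤ m) (hn : 1 ≤ n) (hk : 1 ≤ k)
    (L : (((Fin n × MultiIndexLen m k) → ℝ) × (Fin d → ℝ)) → ℝ)
    (hL : ContDiff ℝ (⊤ : ℕ∞) L)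
    (hproj : ∀ H : Fin m → ℕ, (∑ i, H i = 2 * k) → ∀ α β : Fin n,
      ∀ z : ((Fin n × MultiIndexLen m k) → ℝ) × (Fin d → ℝ),
        ∑ p ∈ Finset.univ.filter
            (fun p : MultiIndexLen m k × MultiIndexLen m k => p.1.1 + p.2.1 = H),
          iteratedFDeriv ℝ 2 L z ![basisVec m n k d (α, p.1), basisVec m n k d (β, p.2)]
            = 0) :
    ∀ c : Fin (Fintype.card (MultiIndexLen m k) + 1) → Fin n × MultiIndexLen m k,
      ∀ z : ((Fin n × MultiIndexLen m k) → ℝ) × (Fin d → ℝ),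
        iteratedFDeriv ℝ (Fintype.card (MultiIndexLen m k) + 1) L z
          (fun i => basisVec m n k d (c i)) = 0 := by
  have main : ∀ (D : ℕ)
      (c : Fin (Fintype.card (MultiIndexLen m k) + 1) → Fin n × MultiIndexLen m k),
      (Fintype.card (MultiIndexLen m k) + 1) * k ^ 2 ≤ (∑ x, ∑ l, (c x).2.1 l ^ 2) + D →
      ∀ z, iteratedFDeriv ℝ (Fintype.card (MultiIndexLen m k) + 1) L z
        (fun i => basisVec m n k d (c i)) = 0 := by
    intro D
    induction D using Nat.strong_induction_on with
    | _ D ih =>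
    intro c hc z
    obtain ⟨i, j, hij, hJ⟩ := Fintype.exists_ne_map_eq_of_card_lt (fun x => (c x).2) (by simp)
    have hsum := sum_iteratedFDeriv_update_eq_zero hL _ _ _
      (hproj ((c i).2.1 + (c i).2.1)
        (by simp only [Pi.add_apply, Finset.sum_add_distrib, (c i).2.2]; ring) (c i).1 (c j).1)
      (basisVec m n k d ∘ c) hij z
    simp only [← Function.comp_update] at hsum
    rw [Finset.sum_eq_single_of_mem ((c i).2, (c i).2) (by simp)] at hsum
    · rwa [show ((c j).1, (c i).2) = c j from Prod.ext rfl hJ, Prod.mk.eta,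
        Function.update_eq_self, Function.update_eq_self] at hsum
    · rintro ⟨K, K'⟩ hK hne
      have hKK : K.1 + K'.1 = (c i).2.1 + (c i).2.1 := (Finset.mem_filter.1 hK).2
      have hKJ : K.1 ≠ (c i).2.1 := by
        intro h
        rw [h] at hKK
        exact hne (Prod.ext (Subtype.ext h) (Subtype.ext (add_left_cancel hKK)))
      have hlt := two_mul_sum_sq_lt hKK hKJ
      have hupd := sum_update_update_add
        (fun a : Fin n × MultiIndexLen m k => ∑ l, a.2.1 l ^ 2) c hij ((c i).1, K) ((c j).1, K')
      have hbound : ∑ x, ∑ l, (Function.update (Function.update c i ((c i).1, K)) j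
          ((c j).1, K') x).2.1 l ^ 2 ≤ (Fintype.card (MultiIndexLen m k) + 1) * k ^ 2 := by
        refine (Finset.sum_le_card_nsmul _ _ _ fun x _ => MultiIndexLen.sum_sq_le _).trans ?_
        simp
      have hJ' : (c i).2 = (c j).2 := hJ
      simp only [← hJ'] at hupd
      exact ih (D - 1) (by omega) _ (by dsimp only; omega) z
  exact fun c => main _ c le_add_self
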